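/- arXiv:2207.08477 — 3 statements merged into one kernel-verified Lean document; each statement's English description precedes it below -/
import Mathlib

section
/- Let P ⊂ ℝⁿ be an n-dimensional polytope, let u be a unit vector, and define f : ℝ → ℝ by f(t) = vol_{n−1}((t·u + u^⊥) ∩ P)^{1/(n−1)}, where u^⊥ is the orthogonal complement of the line spanned by u. Let [α, β] be the support of f. If f is affine on [α, β] and f(β) = 0, then P is a pyramid with base (α·u + u^⊥) ∩ P and apex the single point of (β·u + u^⊥) ∩ P; that is, (β·u + u^⊥) ∩ P is a singleton {w} and P = conv(((α·u + u^⊥) ∩ P) ∪ {w}). -/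
open MeasureTheory Module
open scoped RealInnerProductSpace MeasureTheory Pointwise

section AddHaar

variable {V : Type*} [NormedAddCommGroup V] [NormedSpace ℝ V] [FiniteDimensional ℝ V]
  [MeasurableSpace V] [BorelSpace V] (μ : Measure V) [μ.IsAddHaarMeasure]

/-- A convex set of positive Haar measure has nonempty interior. -/
lemma Convex.interior_nonempty_of_addHaar_ne_zero {L : Set V} (hL : Convex ℝ L)
    (h0 : μ L ≠ 0) : (interior L).Nonempty := by
  by_contra h
  rw [Set.not_nonempty_iff_eq_empty] at h
  refine h0 (measure_mono_null ?_ (hL.addHaar_frontier μ))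
  intro x hx
  rw [frontier, h, Set.sdiff_empty]
  exact subset_closure hx

/-- A closed subset of full measure in a convex set of positive finite measure is everything. -/
lemma Convex.subset_of_addHaar_le {K L : Set V} (hL : Convex ℝ L) (hK : IsClosed K) (hKL : K ⊆ L)
    (h0 : μ L ≠ 0) (htop : μ L ≠ ⊤) (hle : μ L ≤ μ K) : L ⊆ K := by
  have hdiff : μ (L \ K) = 0 := by
    rw [measure_sdiff hKL hK.measurableSet.nullMeasurableSet (measure_ne_top_of_subset hKL htop)]
    exact tsub_eq_zero_of_le hle
  have hempty : interior L \ K = ∅ :=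
    (isOpen_interior.sdiff hK).eq_empty_of_measure_zero (μ := μ)
      (measure_mono_null (Set.sdiff_subset_sdiff_left interior_subset) hdiff)
  calc L ⊆ closure L := subset_closure
    _ = closure (interior L) :=
      (hL.closure_interior_eq_closure_of_nonempty_interior
        (hL.interior_nonempty_of_addHaar_ne_zero μ h0)).symm
    _ ⊆ K := closure_minimal (Set.sdiff_eq_empty.1 hempty) hK

end AddHaar

section Slice

variable {E : Type*} [NormedAddCommGroup E] [InnerProductSpace ℝ E]

/-- The section of `P` at height `t` in direction `u`, translated to the hyperplane `uᗮ`. -/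
def orthogonalSlice (P : Set E) (u : E) (t : ℝ) : Set (Submodule.span ℝ {u})ᗮ :=
  {v | t • u + (v : E) ∈ P}

lemma image_orthogonalSlice (P : Set E) (u : E) (t : ℝ) :
    (fun v : (Submodule.span ℝ {u})ᗮ => t • u + (v : E)) '' orthogonalSlice P u t =
      (t • u +ᵥ ((Submodule.span ℝ {u})ᗮ : Set E)) ∩ P := by
  ext x
  simp only [Set.mem_image, Set.mem_inter_iff, Set.mem_vadd_set, orthogonalSlice,
    Set.mem_ofPred_eq, vadd_eq_add]
  constructor
  · rintro ⟨v, hv, rfl⟩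
    exact ⟨⟨v, v.2, rfl⟩, hv⟩
  · rintro ⟨⟨v, hv, rfl⟩, hx⟩
    exact ⟨⟨v, hv⟩, hx, rfl⟩

lemma isometry_smul_add_orthogonal (u : E) (t : ℝ) :
    Isometry (fun v : (Submodule.span ℝ {u})ᗮ => t • u + (v : E)) :=
  (isometry_add_left (t • u)).comp isometry_subtype_coe

lemma Convex.orthogonalSlice {P : Set E} (hP : Convex ℝ P) (u : E) (t : ℝ) :
    Convex ℝ (orthogonalSlice P u t) := by
  intro x hx y hy a b ha hb hab
  have h := hP hx hy ha hb hab
  have e : a • (t • u + (x : E)) + b • (t • u + (y : E)) = t • u + (a • (x : E) + b • (y : E)) := by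
    obtain rfl : b = 1 - a := by linarith
    module
  rw [e] at h
  exact h

lemma IsCompact.orthogonalSlice [FiniteDimensional ℝ E] {P : Set E} (hP : IsCompact P)
    (u : E) (t : ℝ) : IsCompact (orthogonalSlice P u t) :=
  (isometry_smul_add_orthogonal u t).isClosedEmbedding.isCompact_preimage hP

/-- Interpolating between two sections of a convex set stays in the section of the
interpolated height. -/
lemma Convex.image_homothety_orthogonalSlice_subset {P : Set E} (hP : Convex ℝ P) {u : E}
    {α β r : ℝ} (hr0 : 0 ≤ r) (hr1 : r ≤ 1) {w : (Submodule.span ℝ {u})ᗮ}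
    (hw : w ∈ _root_.orthogonalSlice P u β) :
    AffineMap.homothety w r '' _root_.orthogonalSlice P u α ⊆
      _root_.orthogonalSlice P u (r * α + (1 - r) * β) := by
  rintro _ ⟨x, hx, rfl⟩
  have h := hP hx hw hr0 (sub_nonneg.2 hr1) (by ring)
  have e : r • (α • u + (x : E)) + (1 - r) • (β • u + (w : E)) =
      (r * α + (1 - r) * β) • u + ((AffineMap.homothety w r x : (Submodule.span ℝ {u})ᗮ) : E) := by
    simp only [AffineMap.homothety_apply, vsub_eq_sub, vadd_eq_add, Submodule.coe_add,
      Submodule.coe_smul, Submodule.coe_sub]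
    module
  rw [e] at h
  exact h

/-- If interpolating with `w'` lands in the set obtained by interpolating with `w`, then
`w = w'`. -/
lemma eq_of_image_homothety_subset {B : Set E} (hB : IsCompact B) (hne : B.Nonempty) {w w' : E}
    {r : ℝ} (hr0 : 0 ≤ r) (hr1 : r < 1)
    (h : AffineMap.homothety w' r '' B ⊆ AffineMap.homothety w r '' B) : w' = w := by
  obtain ⟨p, hp, hmax⟩ := hB.exists_isMaxOn hne
    (f := fun x => ⟪w' - w, x⟫) (by fun_prop)
  obtain ⟨q, hq, hqe⟩ := h ⟨p, hp, rfl⟩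
  have hle : ⟪w' - w, q⟫ ≤ ⟪w' - w, p⟫ := hmax hq
  simp only [AffineMap.homothety_apply, vsub_eq_sub, vadd_eq_add] at hqe
  have e : r • q = r • p + (1 - r) • (w' - w) := by
    have : r • q = (r • (q - w) + w) - (1 - r) • w := by module
    rw [this, hqe]
    module
  have e2 := congrArg (fun x => ⟪w' - w, x⟫) e
  simp only [inner_add_right, inner_smul_right] at e2
  have h3 : ⟪w' - w, w' - w⟫ ≤ 0 := by
    by_contra! hc
    nlinarith [mul_le_mul_of_nonneg_left hle hr0, mul_pos (sub_pos.2 hr1) hc]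
  exact sub_eq_zero.1 (inner_self_eq_zero.1 (h3.antisymm real_inner_self_nonneg))

lemma exists_mem_orthogonalSlice {P : Set E} {u : E} (hu : ‖u‖ = 1) {x : E} (hx : x ∈ P) :
    ∃ v ∈ orthogonalSlice P u ⟪u, x⟫, ⟪u, x⟫ • u + (v : E) = x := by
  have hv : x - ⟪u, x⟫ • u ∈ (Submodule.span ℝ {u})ᗮ := by
    rw [Submodule.mem_orthogonal_singleton_iff_inner_right, inner_sub_right, inner_smul_right,
      real_inner_self_eq_norm_sq, hu]
    ring
  have e : ⟪u, x⟫ • u + (x - ⟪u, x⟫ • u) = x := by abel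
  exact ⟨⟨_, hv⟩, by simpa [orthogonalSlice] using hx, e⟩

lemma inner_smul_add_orthogonal {u : E} (hu : ‖u‖ = 1) (t : ℝ) (v : (Submodule.span ℝ {u})ᗮ) :
    ⟪u, t • u + (v : E)⟫ = t := by
  rw [inner_add_right, inner_smul_right, real_inner_self_eq_norm_sq, hu,
    Submodule.mem_orthogonal_singleton_iff_inner_right.1 v.2]
  ring

/-- The section through an interior point has positive measure. -/
lemma measure_orthogonalSlice_pos {P : Set E} {u : E} (hu : ‖u‖ = 1)
    [MeasurableSpace (Submodule.span ℝ {u})ᗮ] (μ : Measure (Submodule.span ℝ {u})ᗮ)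
    [μ.IsOpenPosMeasure] {x : E} (hx : x ∈ interior P) :
    0 < μ (orthogonalSlice P u ⟪u, x⟫) := by
  obtain ⟨v, hv, -⟩ := exists_mem_orthogonalSlice hu hx
  have hopen : IsOpen (orthogonalSlice (interior P) u ⟪u, x⟫) :=
    isOpen_interior.preimage (isometry_smul_add_orthogonal u _).continuous
  exact (hopen.measure_pos μ ⟨v, hv⟩).trans_le
    (measure_mono (Set.preimage_mono (f := fun v : (Submodule.span ℝ {u})ᗮ => ⟪u, x⟫ • u + (v : E))
      interior_subset))

end Slice

/-- (Lemma 2.2) Let `P ⊂ ℝⁿ` be an `n`-dimensional polytope, `u` a unit vector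
and `f t = vol_{n-1}((t·u + u^⊥) ∩ P)^{1/(n-1)}`.  If the support of `f` is
`[α, β]`, `f` is affine on `[α, β]` and `f β = 0`, then `P` is a pyramid with
base `(α·u + u^⊥) ∩ P` and apex the single point of `(β·u + u^⊥) ∩ P`. -/
theorem pyramid_of_affine_section_function
    (n : ℕ)
    (P : Set (EuclideanSpace ℝ (Fin n)))
    (S : Set (EuclideanSpace ℝ (Fin n))) (hS : S.Finite)
    (hP : P = convexHull ℝ S)
    (hPdim : affineSpan ℝ P = ⊤)
    (u : EuclideanSpace ℝ (Fin n)) (hu : ‖u‖ = 1)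
    (f : ℝ → ℝ)
    (hf : f = fun t =>
      (μH[((n : ℝ) - 1)]
        ((t • u +ᵥ ((Submodule.span ℝ {u})ᗮ : Set (EuclideanSpace ℝ (Fin n)))) ∩ P)).toReal
        ^ ((1 : ℝ) / ((n : ℝ) - 1)))
    (α β : ℝ)
    (hsupp : closure {t | 0 < f t} = Set.Icc α β)
    (haff : ∃ c d : ℝ, ∀ t ∈ Set.Icc α β, f t = c * t + d)
    (hfβ : f β = 0) :
    ∃ w : EuclideanSpace ℝ (Fin n),
      (β • u +ᵥ ((Submodule.span ℝ {u})ᗮ : Set (EuclideanSpace ℝ (Fin n)))) ∩ P = {w} ∧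
      P = convexHull ℝ
        (((α • u +ᵥ ((Submodule.span ℝ {u})ᗮ : Set (EuclideanSpace ℝ (Fin n)))) ∩ P) ∪ {w}) := by
  have hn0 : n ≠ 0 := by
    rintro rfl
    simp [Subsingleton.elim u 0] at hu
  have hn1 : n ≠ 1 := by
    rintro rfl
    simp [hf] at hfβ
  have hconv : Convex ℝ P := hP ▸ convex_convexHull ℝ S
  have hcomp : IsCompact P := by
    rw [hP]
    exact hS.isCompact_convexHull (𝕜 := ℝ)
  have hint : (interior P).Nonempty := hconv.interior_nonempty_iff_affineSpan_eq_top.2 hPdim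
  have hu0 : u ≠ 0 := by
    rintro rfl
    simp at hu
  obtain ⟨m, rfl⟩ : ∃ m, n = m + 1 := Nat.exists_eq_succ_of_ne_zero hn0
  have hm0 : m ≠ 0 := by simpa using hn1
  have : Fact (finrank ℝ (EuclideanSpace ℝ (Fin (m + 1))) = m + 1) := ⟨finrank_euclideanSpace_fin⟩
  have hfr : finrank ℝ (Submodule.span ℝ {u})ᗮ = m := Submodule.finrank_orthogonal_span_singleton hu0
  have hcast : ((m + 1 : ℕ) : ℝ) - 1 = (finrank ℝ (Submodule.span ℝ {u})ᗮ : ℝ) := by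
    rw [hfr]
    push_cast
    ring
  set μ : Measure (Submodule.span ℝ {u})ᗮ := μH[(finrank ℝ (Submodule.span ℝ {u})ᗮ : ℝ)] with hμ
  have hfin : ∀ t, μ (orthogonalSlice P u t) ≠ ⊤ := fun t =>
    (hcomp.orthogonalSlice u t).measure_lt_top.ne
  have hft : ∀ t, f t = (μ (orthogonalSlice P u t)).toReal ^ ((1 : ℝ) / m) := by
    intro t
    simp only [hf]
    rw [← image_orthogonalSlice, hcast,
      (isometry_smul_add_orthogonal u t).hausdorffMeasure_image (Or.inl (by positivity)), hfr]
    simp only [hμ, hfr]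
  have hfpow : ∀ t, f t ^ m = (μ (orthogonalSlice P u t)).toReal := by
    intro t
    rw [hft, one_div, Real.rpow_inv_natCast_pow ENNReal.toReal_nonneg hm0]
  have hfnn : ∀ t, 0 ≤ f t := fun t => by
    rw [hft]
    positivity
  have hpos_int : ∀ x ∈ interior P, 0 < f ⟪u, x⟫ := by
    intro x hx
    rw [hft]
    exact Real.rpow_pos_of_pos
      (ENNReal.toReal_pos (measure_orthogonalSlice_pos hu μ hx).ne' (hfin _)) _
  have hPIcc : ∀ x ∈ P, ⟪u, x⟫ ∈ Set.Icc α β := by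
    intro x hx
    rw [← hsupp]
    have hx' : x ∈ closure (interior P) := by
      rw [hconv.closure_interior_eq_closure_of_nonempty_interior hint]
      exact subset_closure hx
    exact map_mem_closure (f := fun y => ⟪u, y⟫) (by fun_prop) hx' hpos_int
  obtain ⟨z, hz⟩ := hint
  have hzI := hPIcc z (interior_subset hz)
  have hαβ : α ≤ β := hzI.1.trans hzI.2
  have hsub : closure {t | 0 < f t} ⊆ (fun y => ⟪u, y⟫) '' P := by
    refine closure_minimal ?_ (hcomp.image (by fun_prop)).isClosed
    intro t ht
    have hne : (orthogonalSlice P u t).Nonempty := by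
      rw [Set.nonempty_iff_ne_empty]
      intro he
      have h0 := hfpow t
      rw [he, measure_empty, ENNReal.toReal_zero] at h0
      exact (pow_pos ht m).ne' h0
    obtain ⟨v, hv⟩ := hne
    exact ⟨_, hv, inner_smul_add_orthogonal hu t v⟩
  obtain ⟨w', hw'P, hw'⟩ : β ∈ (fun y => ⟪u, y⟫) '' P :=
    hsub (hsupp ▸ Set.right_mem_Icc.2 hαβ)
  obtain ⟨w, hw, -⟩ := exists_mem_orthogonalSlice hu hw'P
  rw [show ⟪u, w'⟫ = β from hw'] at hw
  obtain ⟨c, d, hcd⟩ := haff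
  have hβ0 : c * β + d = 0 := by rw [← hcd β (Set.right_mem_Icc.2 hαβ), hfβ]
  have hα : f α = c * α + d := hcd α (Set.left_mem_Icc.2 hαβ)
  have hfz := hpos_int z hz
  have hzβ : ⟪u, z⟫ < β := lt_of_le_of_ne hzI.2 fun h => by
    rw [h, hfβ] at hfz
    exact hfz.false
  have hαpos : 0 < f α := by
    rw [hcd _ hzI] at hfz
    have hc : c < 0 := by
      by_contra! hc
      nlinarith
    rw [hα]
    nlinarith [hzI.1]
  have hBα : (orthogonalSlice P u α).Nonempty := by
    obtain ⟨y, hy, hye⟩ := hsub (subset_closure hαpos)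
    obtain ⟨v, hv, -⟩ := exists_mem_orthogonalSlice hu hy
    rw [show ⟪u, y⟫ = α from hye] at hv
    exact ⟨v, hv⟩
  have hkey : ∀ w₀ ∈ orthogonalSlice P u β, ∀ r : ℝ, 0 < r → r ≤ 1 →
      orthogonalSlice P u (r * α + (1 - r) * β) =
        AffineMap.homothety w₀ r '' orthogonalSlice P u α := by
    intro w₀ hw₀ r hr0 hr1
    have hfr' : f (r * α + (1 - r) * β) = r * f α := by
      rw [hcd _ ⟨by nlinarith, by nlinarith⟩, hα]
      linear_combination (1 - r) * hβ0
    have hvol := hfpow (r * α + (1 - r) * β)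
    rw [hfr', mul_pow, hfpow α] at hvol
    have hlpos : 0 < r ^ m * (μ (orthogonalSlice P u α)).toReal := by
      rw [← hfpow α]
      positivity
    refine Set.Subset.antisymm ?_ (hconv.image_homothety_orthogonalSlice_subset hr0.le hr1 hw₀)
    refine (hconv.orthogonalSlice u _).subset_of_addHaar_le μ
      ((hcomp.orthogonalSlice u α).image (AffineMap.homothety_continuous w₀ r)).isClosed
      (hconv.image_homothety_orthogonalSlice_subset hr0.le hr1 hw₀) ?_ (hfin _) ?_
    · intro h0
      rw [h0, ENNReal.toReal_zero] at hvol
      exact hlpos.ne' hvol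
    · rw [Measure.addHaar_image_homothety, hfr, abs_of_pos (pow_pos hr0 m),
        ← ENNReal.ofReal_toReal (hfin (r * α + (1 - r) * β)), ← hvol,
        ENNReal.ofReal_mul (by positivity), ENNReal.ofReal_toReal (hfin α)]
  have hBβ : orthogonalSlice P u β = {w} := by
    refine Set.eq_singleton_iff_unique_mem.2 ⟨hw, fun v hv => ?_⟩
    refine eq_of_image_homothety_subset (hcomp.orthogonalSlice u α) hBα
      (r := 1 / 2) (by norm_num) (by norm_num) ?_
    rw [← hkey v hv _ (by norm_num) (by norm_num), ← hkey w hw _ (by norm_num) (by norm_num)]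
  refine ⟨β • u + (w : EuclideanSpace ℝ (Fin (m + 1))), ?_, Set.Subset.antisymm ?_ ?_⟩
  · rw [← image_orthogonalSlice, hBβ, Set.image_singleton]
  · intro x hx
    obtain ⟨v, hv, hvx⟩ := exists_mem_orthogonalSlice hu hx
    have hxI := hPIcc x hx
    rcases hxI.2.eq_or_lt with hxβ | hxβ
    · rw [hxβ, hBβ, Set.mem_singleton_iff] at hv
      refine subset_convexHull ℝ _ (Or.inr ?_)
      rw [Set.mem_singleton_iff, ← hvx, hv, hxβ]
    · have hlt : 0 < β - α := by linarith [hxI.1]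
      obtain ⟨r, hr⟩ : ∃ r, r = (β - ⟪u, x⟫) / (β - α) := ⟨_, rfl⟩
      have hr0 : 0 < r := hr ▸ div_pos (by linarith) hlt
      have hr1 : r ≤ 1 := hr ▸ (div_le_one hlt).2 (by linarith [hxI.1])
      have hrx : r * α + (1 - r) * β = ⟪u, x⟫ := by
        rw [hr]
        field_simp
        ring
      rw [← hrx, hkey w hw r hr0 hr1] at hv
      obtain ⟨b, hb, rfl⟩ := hv
      have hbα : α • u + (b : EuclideanSpace ℝ (Fin (m + 1))) ∈
          (α • u +ᵥ ((Submodule.span ℝ {u})ᗮ : Set (EuclideanSpace ℝ (Fin (m + 1))))) ∩ P := by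
        rw [← image_orthogonalSlice]
        exact ⟨b, hb, rfl⟩
      have h := (convex_convexHull ℝ _) (subset_convexHull ℝ _ (Set.mem_union_left _ hbα))
        (subset_convexHull ℝ _ (Set.mem_union_right _
          (Set.mem_singleton (β • u + (w : EuclideanSpace ℝ (Fin (m + 1)))))))
        hr0.le (sub_nonneg.2 hr1) (by ring)
      convert h using 1
      rw [← hvx, ← hrx]
      simp only [AffineMap.homothety_apply, vsub_eq_sub, vadd_eq_add, Submodule.coe_add,
        Submodule.coe_smul, Submodule.coe_sub]
      module
  · refine convexHull_min (Set.union_subset Set.inter_subset_right ?_) hconv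
    exact Set.singleton_subset_iff.2 hw
end

section
/- Let P ⊂ ℝⁿ be an n-dimensional polytope and suppose P = conv(Q₁ ∪ Q₂), where Q₁, Q₂ ⊂ ℝⁿ are polytopes with dim Q₁ + dim Q₂ = n − 1 and aff Q₁ ∩ aff Q₂ = ∅. Then Q₁ and Q₂ are faces of P. -/
open MeasureTheory Module
open scoped RealInnerProductSpace

/-- If a linear functional is constant on each of two convex sets, with a smaller value on the
first, then the first is an extreme subset of the convex hull of their union. -/
theorem isExtreme_convexHull_union_left {E : Type*} [AddCommGroup E] [Module ℝ E] {A B : Set E}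
    (hA : Convex ℝ A) (hB : Convex ℝ B) (hA₀ : A.Nonempty) (hB₀ : B.Nonempty)
    (f : E →ₗ[ℝ] ℝ) {a b : ℝ} (hab : a < b) (hfA : ∀ x ∈ A, f x = a) (hfB : ∀ x ∈ B, f x = b) :
    IsExtreme ℝ (convexHull ℝ (A ∪ B)) A := by
  have key : ∀ x ∈ convexHull ℝ (A ∪ B), a ≤ f x ∧ (f x = a → x ∈ A) := by
    intro x hx
    rw [hA.convexHull_union hB hA₀ hB₀, mem_convexJoin] at hx
    obtain ⟨p, hp, q, hq, s, t, hs, ht, hst, rfl⟩ := hx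
    obtain rfl : s = 1 - t := by linarith
    have hf : f ((1 - t) • p + t • q) = a + t * (b - a) := by
      simp only [map_add, map_smul, hfA p hp, hfB q hq, smul_eq_mul]
      ring
    rw [hf]
    refine ⟨by nlinarith, fun h => ?_⟩
    have ht₀ : t = 0 := by
      have : t * (b - a) = 0 := by linarith
      exact (mul_eq_zero.1 this).resolve_right (by linarith)
    simpa [ht₀] using hp
  refine ⟨Set.subset_union_left.trans (subset_convexHull ℝ _), ?_⟩
  rintro x hx y hy z hz ⟨s, t, hs, ht, hst, rfl⟩
  have hz' := hfA _ hz
  simp only [map_add, map_smul, smul_eq_mul] at hz'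
  refine (key x hx).2 (le_antisymm ?_ (key x hx).1)
  have hya : t * a ≤ t * f y := mul_le_mul_of_nonneg_left (key y hy).1 ht.le
  obtain rfl : t = 1 - s := by linarith
  exact le_of_mul_le_mul_left (by linarith) hs

/-- Two affine subspaces that together span the whole space and whose directions are too small to
span its vector space are separated by a linear functional constant on each of them. -/
theorem exists_linearMap_const_of_sup_eq_top {E : Type*} [AddCommGroup E] [Module ℝ E]
    [FiniteDimensional ℝ E] {s t : AffineSubspace ℝ E} {p q : E} (hp : p ∈ s) (hq : q ∈ t)
    (hst : s ⊔ t = ⊤)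
    (hdim : finrank ℝ s.direction + finrank ℝ t.direction < finrank ℝ E) :
    ∃ f : E →ₗ[ℝ] ℝ, f p < f q ∧ (∀ x ∈ s, f x = f p) ∧ ∀ x ∈ t, f x = f q := by
  have hv : q - p ∉ s.direction ⊔ t.direction := by
    intro hv
    have htop := AffineSubspace.direction_sup hp hq
    rw [hst, AffineSubspace.direction_top, vsub_eq_sub,
      sup_eq_left.2 ((Submodule.span_singleton_le_iff_mem _ _).2 hv)] at htop
    have := Submodule.finrank_add_le_finrank_add_finrank s.direction t.direction
    rw [← htop, finrank_top] at this
    omega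
  obtain ⟨g, hg, hker⟩ := Submodule.exists_le_ker_of_notMem hv
  have hconst : ∀ x y, x - y ∈ s.direction ⊔ t.direction → g x = g y := fun x y h =>
    sub_eq_zero.1 (by simpa using hker h)
  have hgs : ∀ x ∈ s, g x = g p := fun x hx =>
    hconst x p (Submodule.mem_sup_left (AffineSubspace.vsub_mem_direction hx hp))
  have hgt : ∀ x ∈ t, g x = g q := fun x hx =>
    hconst x q (Submodule.mem_sup_right (AffineSubspace.vsub_mem_direction hx hq))
  rw [map_sub, sub_ne_zero] at hg
  rcases hg.lt_or_gt with h | h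
  · exact ⟨-g, by simpa using h, fun x hx => by simp [hgs x hx], fun x hx => by simp [hgt x hx]⟩
  · exact ⟨g, h, hgs, hgt⟩

/-- If an `n`-dimensional polytope `P ⊂ ℝⁿ` can be written as
`P = conv(Q₁ ∪ Q₂)` with `Q₁, Q₂` polytopes satisfying
`dim Q₁ + dim Q₂ = n - 1` and `aff Q₁ ∩ aff Q₂ = ∅`, then `Q₁` and `Q₂` are
faces of `P`. -/
theorem join_factors_are_faces
    (n : ℕ)
    (P Q₁ Q₂ : Set (EuclideanSpace ℝ (Fin n)))
    (S₁ S₂ : Set (EuclideanSpace ℝ (Fin n)))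
    (hS₁ : S₁.Finite) (hS₁ne : S₁.Nonempty) (hQ₁ : Q₁ = convexHull ℝ S₁)
    (hS₂ : S₂.Finite) (hS₂ne : S₂.Nonempty) (hQ₂ : Q₂ = convexHull ℝ S₂)
    (hP : P = convexHull ℝ (Q₁ ∪ Q₂))
    (hPdim : affineSpan ℝ P = ⊤)
    (hdim : finrank ℝ (affineSpan ℝ Q₁).direction
      + finrank ℝ (affineSpan ℝ Q₂).direction + 1 = n)
    (hdisj : (affineSpan ℝ Q₁ : Set (EuclideanSpace ℝ (Fin n))) ∩
      (affineSpan ℝ Q₂ : Set (EuclideanSpace ℝ (Fin n))) = ∅) :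
    IsExtreme ℝ P Q₁ ∧ IsExtreme ℝ P Q₂ := by
  have hc₁ : Convex ℝ Q₁ := hQ₁ ▸ convex_convexHull ℝ S₁
  have hc₂ : Convex ℝ Q₂ := hQ₂ ▸ convex_convexHull ℝ S₂
  obtain ⟨p, hp⟩ : Q₁.Nonempty := hQ₁ ▸ hS₁ne.convexHull
  obtain ⟨q, hq⟩ : Q₂.Nonempty := hQ₂ ▸ hS₂ne.convexHull
  have hsup : affineSpan ℝ Q₁ ⊔ affineSpan ℝ Q₂ = ⊤ := by
    rw [← AffineSubspace.span_union, ← affineSpan_convexHull, ← hP, hPdim]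
  obtain ⟨f, hlt, hf₁, hf₂⟩ := exists_linearMap_const_of_sup_eq_top
    (mem_affineSpan ℝ hp) (mem_affineSpan ℝ hq) hsup
    (by rw [finrank_euclideanSpace_fin]; omega)
  replace hf₁ : ∀ x ∈ Q₁, f x = f p := fun x hx => hf₁ x (mem_affineSpan ℝ hx)
  replace hf₂ : ∀ x ∈ Q₂, f x = f q := fun x hx => hf₂ x (mem_affineSpan ℝ hx)
  rw [hP]
  refine ⟨isExtreme_convexHull_union_left hc₁ hc₂ ⟨p, hp⟩ ⟨q, hq⟩ f hlt hf₁ hf₂, ?_⟩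
  rw [Set.union_comm]
  exact isExtreme_convexHull_union_left hc₂ hc₁ ⟨q, hq⟩ ⟨p, hp⟩ (-f) (neg_lt_neg hlt)
    (fun x hx => by simp [hf₂ x hx]) (fun x hx => by simp [hf₁ x hx])
end

section
/- Let P = {x ∈ ℝⁿ : ⟨a_i, x⟩ ≤ 1, 1 ≤ i ≤ m} be a centered n-dimensional polytope (irredundant description, 0 ∈ int P), let v be a vertex of P, and let I = {i : ⟨a_i, v⟩ = 1}. Then Σ_{i ∈ I} vol(C_i) ≤ (n/(n+1)) · vol(P). -/
open MeasureTheory Module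
open scoped RealInnerProductSpace

section

variable {E : Type*} [NormedAddCommGroup E] [InnerProductSpace ℝ E]

/-- Any ray from a point `v` of a bounded polyhedron through another point `x` leaves the polyhedron
through a facet whose hyperplane does not contain `v`. -/
lemma exists_mem_segment_facet {ι : Type*} [Finite ι] {a : ι → E} {P : Set E}
    (hP : P = {x | ∀ i, ⟪a i, x⟫ ≤ 1}) (hbd : Bornology.IsBounded P) {v x : E} (hv : v ∈ P)
    (hx : x ∈ P) (hxv : x ≠ v) :
    ∃ i, ⟪a i, v⟫ ≠ 1 ∧ ∃ y ∈ P, ⟪a i, y⟫ = 1 ∧ x ∈ segment ℝ v y := by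
  have := Fintype.ofFinite ι
  classical
  obtain ⟨R, hR⟩ := hbd.exists_norm_le
  subst hP
  obtain ⟨d, rfl⟩ : ∃ d, x = v + d := ⟨x - v, by simp⟩
  have hd : 0 < ‖d‖ := norm_pos_iff.2 fun h ↦ hxv (by simp [h])
  have hJ : (Finset.univ.filter fun i ↦ 0 < ⟪a i, d⟫).Nonempty := by
    by_contra! hJ
    have hneg : ∀ i, ⟪a i, d⟫ ≤ 0 := fun i ↦ by
      by_contra! hi
      have : i ∈ Finset.univ.filter fun i ↦ 0 < ⟪a i, d⟫ := by simp [hi]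
      simp [hJ] at this
    have hR0 : 0 ≤ R := (norm_nonneg v).trans (hR v hv)
    have ht : 0 ≤ (R + ‖v‖ + 1) / ‖d‖ := by positivity
    have hmem := hR (v + ((R + ‖v‖ + 1) / ‖d‖) • d) fun i ↦ by
      rw [inner_add_right, inner_smul_right]
      nlinarith [hv i, mul_nonneg ht (neg_nonneg.2 (hneg i))]
    have h1 := norm_sub_le (v + ((R + ‖v‖ + 1) / ‖d‖) • d) v
    rw [add_sub_cancel_left, norm_smul, Real.norm_of_nonneg ht, div_mul_cancel₀ _ hd.ne'] at h1
    linarith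
  obtain ⟨i, hi, hmin⟩ := Finset.exists_min_image _ (fun i ↦ (1 - ⟪a i, v⟫) / ⟪a i, d⟫) hJ
  simp only [Finset.mem_filter, Finset.mem_univ, true_and] at hi hmin
  have hxi := hx i
  rw [inner_add_right] at hxi
  set T := (1 - ⟪a i, v⟫) / ⟪a i, d⟫ with hT
  have hT1 : 1 ≤ T := (one_le_div hi).2 (by linarith)
  have hTd : T * ⟪a i, d⟫ = 1 - ⟪a i, v⟫ := div_mul_cancel₀ _ hi.ne'
  refine ⟨i, by intro h; linarith, v + T • d, fun j ↦ ?_, ?_, ?_⟩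
  · rw [inner_add_right, inner_smul_right]
    rcases lt_or_ge 0 ⟪a j, d⟫ with hj | hj
    · have := (le_div_iff₀ hj).1 (hmin j hj)
      linarith
    · nlinarith [hv j]
  · rw [inner_add_right, inner_smul_right]
    linarith
  · rw [segment_eq_image']
    refine ⟨T⁻¹, ⟨by positivity, inv_le_one_of_one_le₀ hT1⟩, ?_⟩
    simp [smul_smul, inv_mul_cancel₀ (zero_lt_one.trans_le hT1).ne']

lemma inner_le_inner_of_mem_convexHull_facet {ι : Type*} {a : ι → E} {P : Set E}
    (hP : P = {x | ∀ i, ⟪a i, x⟫ ≤ 1}) {i : ι} {x : E}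
    (hx : x ∈ convexHull ℝ ({0} ∪ (P ∩ {x | ⟪a i, x⟫ = 1}))) (j : ι) :
    ⟪a j, x⟫ ≤ ⟪a i, x⟫ := by
  have hc : Convex ℝ {x : E | innerₛₗ ℝ (a j - a i) x ≤ 0} :=
    convex_halfSpace_le (LinearMap.isLinear _) 0
  have := convexHull_min (s := {0} ∪ (P ∩ {x | ⟪a i, x⟫ = 1})) ?_ hc hx
  · simpa [inner_sub_left] using this
  · subst hP
    rintro y (rfl | ⟨hy, hyi⟩)
    · simp
    · have := hy j
      simp only [Set.mem_ofPred_eq] at hyi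
      simp [hyi, this]

variable [FiniteDimensional ℝ E] [MeasurableSpace E] [BorelSpace E]

/-- Moving the apex of a cone over a subset of `{x | ⟪a, x⟫ = 1}` from `0` to `v` multiplies its
volume by `|1 - ⟪a, v⟫|`. -/
lemma volume_convexHull_insert_hyperplane (a v : E) {F : Set E} (hF : ∀ x ∈ F, ⟪a, x⟫ = 1) :
    volume (convexHull ℝ ({v} ∪ F)) =
      ENNReal.ofReal |1 - ⟪a, v⟫| * volume (convexHull ℝ ({0} ∪ F)) := by
  let L : E →ₗ[ℝ] E := LinearMap.transvection (innerₛₗ ℝ a) (-v)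
  have hL (x : E) : L x = x - ⟪a, x⟫ • v := by
    simp [L, LinearMap.transvection.apply, sub_eq_add_neg]
  have himg : (AffineMap.const ℝ E v + L.toAffineMap) '' ({0} ∪ F) = {v} ∪ F := by
    rw [Set.image_union, Set.image_singleton]
    congr 1
    · simp
    · refine (Set.image_congr fun x hx ↦ ?_).trans (Set.image_id F)
      simp [hL, hF x hx]
  have hdet : L.det = 1 - ⟪a, v⟫ := by
    simp [L, sub_eq_add_neg]
  rw [← himg, ← AffineMap.image_convexHull]
  have : (AffineMap.const ℝ E v + L.toAffineMap : E → E) = (fun x ↦ v + x) ∘ L := by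
    ext x; simp
  rw [AffineMap.coe_add, this, Set.image_comp, Set.image_add_left, measure_preimage_add,
    Measure.addHaar_image_linearMap, hdet]

/-- A nonnegative affine function on a convex body of dimension `n` has integral at least
`1 / (n + 1)` times the volume times its value at any point of the body. -/
lemma inv_mul_le_setIntegral_one_sub_inner {P : Set E} (hc : Convex ℝ P)
    (hPm : MeasurableSet P) (hfin : volume P ≠ ⊤) {a v : E} (hv : v ∈ P)
    (ha : ∀ x ∈ P, ⟪a, x⟫ ≤ 1) (hint : IntegrableOn (fun x ↦ 1 - ⟪a, x⟫) P) :
    (1 - ⟪a, v⟫) / (finrank ℝ E + 1) * volume.real P ≤ ∫ x in P, (1 - ⟪a, x⟫) := by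
  set n := finrank ℝ E
  set c := 1 - ⟪a, v⟫ with hcdef
  have hnn : 0 ≤ᵐ[volume.restrict P] fun x ↦ 1 - ⟪a, x⟫ :=
    (ae_restrict_iff' hPm).2 (.of_forall fun x hx ↦ sub_nonneg.2 (ha x hx))
  rcases (sub_nonneg.2 (ha v hv)).eq_or_lt with hc0 | hc0
  · rw [hcdef, ← hc0]
    simpa using integral_nonneg_of_ae hnn
  have hslice : ∀ t ∈ Set.Ioc 0 c, ENNReal.ofReal ((1 - t / c) ^ n) * volume P ≤
      volume.restrict P {x | t ≤ 1 - ⟪a, x⟫} := by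
    intro t ht
    have hs0 : 0 ≤ 1 - t / c := sub_nonneg.2 ((div_le_one hc0).2 ht.2)
    have hs1 : 1 - t / c ≤ 1 := by have := div_nonneg ht.1.le hc0.le; linarith
    have hsub : AffineMap.homothety v (1 - t / c) '' P ⊆ {x | t ≤ 1 - ⟪a, x⟫} ∩ P := by
      rintro _ ⟨x, hx, rfl⟩
      have htc : t / c * c = t := div_mul_cancel₀ _ hc0.ne'
      refine ⟨?_, ?_⟩
      · have := mul_nonneg hs0 (sub_nonneg.2 (ha x hx))
        simp only [AffineMap.homothety_apply, vsub_eq_sub, vadd_eq_add, Set.mem_ofPred_eq,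
          inner_add_right, inner_smul_right, inner_sub_right]
        nlinarith
      · rw [AffineMap.homothety_eq_lineMap]
        exact hc.lineMap_mem hv hx ⟨hs0, hs1⟩
    calc ENNReal.ofReal ((1 - t / c) ^ n) * volume P
        = volume (AffineMap.homothety v (1 - t / c) '' P) := by
          rw [Measure.addHaar_image_homothety, abs_of_nonneg (pow_nonneg hs0 _)]
      _ ≤ volume ({x | t ≤ 1 - ⟪a, x⟫} ∩ P) := measure_mono hsub
      _ = _ := (Measure.restrict_apply' hPm).symm
  have hval : ∫ t in Set.Ioc 0 c, (1 - t / c) ^ n = c / (n + 1) := by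
    rw [← intervalIntegral.integral_of_le hc0.le,
      intervalIntegral.integral_comp_sub_div (fun t ↦ t ^ n) hc0.ne']
    rw [zero_div, sub_zero, div_self hc0.ne', sub_self, integral_pow, smul_eq_mul]
    simp [hcdef, div_eq_mul_inv]
  have hpow : ENNReal.ofReal (c / (n + 1)) =
      ∫⁻ t in Set.Ioc 0 c, ENNReal.ofReal ((1 - t / c) ^ n) := by
    rw [← hval]
    refine ofReal_integral_eq_lintegral_ofReal ?_ ?_
    · exact (by fun_prop : Continuous fun t : ℝ ↦ (1 - t / c) ^ n).integrableOn_Ioc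
    · refine (ae_restrict_iff' measurableSet_Ioc).2 (.of_forall fun t ht ↦ ?_)
      exact pow_nonneg (sub_nonneg.2 ((div_le_one hc0).2 ht.2)) n
  rw [← ENNReal.ofReal_le_ofReal_iff (integral_nonneg_of_ae hnn),
    ofReal_integral_eq_lintegral_ofReal hint hnn,
    lintegral_eq_lintegral_meas_le _ hnn hint.aemeasurable,
    ENNReal.ofReal_mul (by positivity), ofReal_measureReal hfin, hpow,
    ← lintegral_mul_const _ (by fun_prop)]
  exact (setLIntegral_mono' measurableSet_Ioc hslice).trans
    (lintegral_mono_set Set.Ioc_subset_Ioi_self)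

/-- A centered convex body `P` of dimension `n` contained in `{x | ⟪a, x⟫ ≤ 1}` is contained in
`{x | -n ≤ ⟪a, x⟫}`. -/
lemma one_sub_inner_le_finrank_add_one_of_centered {P : Set E} (hc : Convex ℝ P)
    (hcpt : IsCompact P) (hpos : volume P ≠ 0) (hcent : ∫ x in P, x = 0) {a v : E} (hv : v ∈ P)
    (ha : ∀ x ∈ P, ⟪a, x⟫ ≤ 1) : 1 - ⟪a, v⟫ ≤ finrank ℝ E + 1 := by
  have hfin := hcpt.measure_lt_top (μ := volume)
  have hidint : IntegrableOn (fun x : E ↦ x) P := continuous_id.continuousOn.integrableOn_compact hcpt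
  have hone : IntegrableOn (fun _ : E ↦ (1 : ℝ)) P := integrableOn_const hfin.ne
  have hinner : IntegrableOn (fun x ↦ ⟪a, x⟫) P :=
    (by fun_prop : Continuous fun x : E ↦ ⟪a, x⟫).continuousOn.integrableOn_compact hcpt
  have h := inv_mul_le_setIntegral_one_sub_inner hc hcpt.measurableSet hfin.ne hv ha
    (hone.sub hinner)
  have h0 : ∫ x in P, ⟪a, x⟫ = 0 := by
    rw [integral_inner hidint, hcent, inner_zero_right]
  rw [integral_sub hone hinner, h0] at h
  have hvol : 0 < volume.real P := ENNReal.toReal_pos hpos hfin.ne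
  simp only [integral_const, measureReal_restrict_apply_univ, smul_eq_mul, mul_one, sub_zero] at h
  exact (div_le_one (by positivity)).1 (le_of_mul_le_mul_right (by linarith) hvol)

/-- The cones with apex `0` over distinct facets do not overlap, so their volumes add up to at most
that of the polyhedron. -/
lemma sum_volume_convexHull_facet_le {ι : Type*} [Fintype ι] {a : ι → E} {P : Set E}
    (hP : P = {x | ∀ i, ⟪a i, x⟫ ≤ 1}) (hinj : Function.Injective a) :
    ∑ i, volume (convexHull ℝ ({0} ∪ (P ∩ {x | ⟪a i, x⟫ = 1}))) ≤ volume P := by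
  have hc : Convex ℝ P := by
    rw [hP, Set.ofPred_forall]
    exact convex_iInter fun i ↦ convex_halfSpace_le (innerₛₗ ℝ (a i)).isLinear 1
  rw [← measure_biUnion_finset₀]
  · refine measure_mono (Set.iUnion₂_subset fun i _ ↦ convexHull_min ?_ hc)
    rintro x (rfl | hx)
    · simp [hP]
    · exact hx.1
  · intro i _ j _ hij
    refine measure_mono_null (t := (LinearMap.ker (innerₛₗ ℝ (a i - a j)) : Set E)) ?_ ?_
    · rintro x ⟨hi, hj⟩
      have h1 := inner_le_inner_of_mem_convexHull_facet hP hi j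
      have h2 := inner_le_inner_of_mem_convexHull_facet hP hj i
      simp [le_antisymm h1 h2]
    · refine Measure.addHaar_submodule volume _ fun h ↦ hij (hinj (sub_eq_zero.1 ?_))
      rw [LinearMap.ker_eq_top] at h
      exact inner_self_eq_zero.1 (LinearMap.congr_fun h (a i - a j))
  · exact fun i _ ↦ (convex_convexHull ℝ _).nullMeasurableSet volume

end

open Classical in
/-- For a centered `n`-dimensional polytope `P = {x | ⟪a i, x⟫ ≤ 1}`
(irredundant description, `0 ∈ int P`) and a vertex `v` of `P` with index set
`I = {i | ⟪a i, v⟫ = 1}`, the cone volumes satisfy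
`∑_{i ∈ I} vol(C i) ≤ (n/(n+1))·vol(P)`. -/
theorem cone_volume_vertex_inequality
    (n m : ℕ) (a : Fin m → EuclideanSpace ℝ (Fin n))
    (P : Set (EuclideanSpace ℝ (Fin n)))
    (hP : P = {x | ∀ i, ⟪a i, x⟫ ≤ 1})
    (hbd : Bornology.IsBounded P)
    (h0 : (0 : EuclideanSpace ℝ (Fin n)) ∈ interior P)
    (hinj : Function.Injective a)
    (ha0 : ∀ i, a i ≠ 0)
    (hirr : ∀ i, ∃ x, (∀ j, j ≠ i → ⟪a j, x⟫ ≤ 1) ∧ 1 < ⟪a i, x⟫)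
    (hcent : (volume P).toReal⁻¹ • (∫ x in P, x) = 0)
    (v : EuclideanSpace ℝ (Fin n))
    (hv : v ∈ Set.extremePoints ℝ P) :
    ∑ i ∈ Finset.univ.filter (fun i => ⟪a i, v⟫ = 1),
        (volume (convexHull ℝ ({0} ∪ (P ∩ {x | ⟪a i, x⟫ = 1})))).toReal
      ≤ ((n : ℝ) / (n + 1)) * (volume P).toReal := by
  rcases n.eq_zero_or_pos with rfl | hn
  · rw [Finset.sum_eq_zero fun i _ ↦ (ha0 i (Subsingleton.elim _ _)).elim]
    positivity
  have : Nonempty (Fin n) := ⟨⟨0, hn⟩⟩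
  have hc : Convex ℝ P := by
    rw [hP, Set.ofPred_forall]
    exact convex_iInter fun i ↦ convex_halfSpace_le (innerₛₗ ℝ (a i)).isLinear 1
  have hcl : IsClosed P := by
    rw [hP, Set.ofPred_forall]
    exact isClosed_iInter fun i ↦ isClosed_le (by fun_prop) continuous_const
  have hcpt : IsCompact P := Metric.isCompact_of_isClosed_isBounded hcl hbd
  have hfin : volume P ≠ ⊤ := hcpt.measure_lt_top.ne
  have hpos : volume P ≠ 0 := (Measure.measure_pos_of_nonempty_interior _ ⟨0, h0⟩).ne'
  have hcent' : ∫ x in P, x = 0 := (smul_eq_zero.1 hcent).resolve_left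
    (inv_ne_zero (ENNReal.toReal_pos hpos hfin).ne')
  set C : Fin m → ENNReal := fun i ↦ volume (convexHull ℝ ({0} ∪ (P ∩ {x | ⟪a i, x⟫ = 1})))
    with hC
  have hsum : ∑ i, C i ≤ volume P := sum_volume_convexHull_facet_le hP hinj
  have hCfin : ∀ i, C i ≠ ⊤ := fun i ↦ ne_top_of_le_ne_top hfin
    ((Finset.single_le_sum (fun _ _ ↦ zero_le) (Finset.mem_univ i)).trans hsum)
  have hcover : P ⊆ {v} ∪ ⋃ i ∈ Finset.univ.filter (fun i ↦ ¬ ⟪a i, v⟫ = 1),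
      convexHull ℝ ({v} ∪ (P ∩ {x | ⟪a i, x⟫ = 1})) := by
    intro x hx
    by_cases hxv : x = v
    · exact .inl hxv
    obtain ⟨i, hi, y, hy, hyi, hseg⟩ := exists_mem_segment_facet hP hbd hv.1 hx hxv
    refine .inr (Set.mem_biUnion (x := i) (by simpa using hi) ?_)
    exact segment_subset_convexHull (.inl rfl) (.inr ⟨hy, hyi⟩) hseg
  have hPle : volume P ≤ ∑ i with ¬ ⟪a i, v⟫ = 1, ENNReal.ofReal (n + 1) * C i := by
    refine (measure_mono hcover).trans ((measure_union_le _ _).trans ?_)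
    rw [measure_singleton, zero_add]
    refine (measure_biUnion_finset_le _ _).trans (Finset.sum_le_sum fun i _ ↦ ?_)
    have hle : ∀ x ∈ P, ⟪a i, x⟫ ≤ 1 := fun x hx ↦ by
      rw [hP] at hx
      exact hx i
    have hbound := one_sub_inner_le_finrank_add_one_of_centered hc hcpt hpos hcent' hv.1 hle
    rw [finrank_euclideanSpace_fin] at hbound
    rw [volume_convexHull_insert_hyperplane (a i) v fun x hx ↦ hx.2,
      abs_of_nonneg (sub_nonneg.2 (hle v hv.1))]
    gcongr
  have hsumR : ∑ i, (C i).toReal ≤ (volume P).toReal := by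
    rw [← ENNReal.toReal_sum fun i _ ↦ hCfin i]
    exact ENNReal.toReal_mono hfin hsum
  have hPleR : (volume P).toReal ≤ (n + 1) * ∑ i with ¬ ⟪a i, v⟫ = 1, (C i).toReal := by
    have := ENNReal.toReal_mono
      (ENNReal.sum_ne_top.2 fun i _ ↦ ENNReal.mul_ne_top ENNReal.ofReal_ne_top (hCfin i)) hPle
    rwa [← Finset.mul_sum, ENNReal.toReal_mul, ENNReal.toReal_ofReal (by positivity),
      ENNReal.toReal_sum fun i _ ↦ hCfin i] at this
  rw [← Finset.sum_filter_add_sum_filter_not _ (fun i ↦ ⟪a i, v⟫ = 1)] at hsumR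
  rw [div_mul_eq_mul_div, le_div_iff₀ (by positivity)]
  nlinarith [mul_le_mul_of_nonneg_left hsumR (by positivity : (0 : ℝ) ≤ n + 1)]
end
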